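/- Assume n is odd. For i ∈ I_0 and q ∈ ℕ, the map Θ_i^(q) : H_0̄ → W_1̄ defined by D_H(f) ↦ x^ω · (ad ∂_i)^{p^q}(D_H(f)) is a derivation from H_0̄ into W_1̄ of ℤ-degree n − p^q. -/

import Mathlib

open Finsupp Finset

namespace HamSup

variable (F : Type) [Field F]

/-- Monomial index: a multi-exponent for the divided power part and a set of odd indices. -/
abbrev Mono (m n : ℕ) := (Fin m → ℕ) × Finset (Fin n)

/-- The superalgebra `O(m,n)` as the free module on monomials `x^(α) x^u`. -/
abbrev O (m n : ℕ) := Mono m n →₀ F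

variable {m n : ℕ}

/-- The basis monomial `x^(α) x^u`. -/
noncomputable def X (μ : Mono m n) : O F m n := Finsupp.single μ 1

/-- Linear extension of a map defined on basis monomials. -/
noncomputable def extend {N : Type} [AddCommGroup N] [Module F N]
    (v : Mono m n → N) : O F m n →ₗ[F] N :=
  Finsupp.lsum F fun μ => LinearMap.toSpanSingleton F N (v μ)

/-- Number of inversions when concatenating `x^u` and `x^v`. -/
def invCount (u v : Finset (Fin n)) : ℕ :=
  ((u ×ˢ v).filter fun q => q.2 < q.1).card

/-- Product of two basis monomials: divided-power binomial coefficients on the even part and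
a sign (with nilpotency) on the exterior part. -/
noncomputable def mulMono (μ ν : Mono m n) : O F m n :=
  if Disjoint μ.2 ν.2 then
    (((-1 : F) ^ invCount μ.2 ν.2) * ∏ i, ((μ.1 i + ν.1 i).choose (μ.1 i) : F)) •
      X F (μ.1 + ν.1, μ.2 ∪ ν.2)
  else 0

/-- The multiplication of `O(m,n)` as a bilinear map. -/
noncomputable def mulO : O F m n →ₗ[F] O F m n →ₗ[F] O F m n :=
  extend F fun μ => extend F (mulMono F μ)

/-- Even partial derivative `∂_i`, `i ∈ I₀`. -/
noncomputable def pdE (i : Fin m) : O F m n →ₗ[F] O F m n :=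
  extend F fun μ =>
    if μ.1 i = 0 then 0 else X F (Function.update μ.1 i (μ.1 i - 1), μ.2)

/-- Odd partial derivative `∂_j`, `j ∈ I₁`. -/
noncomputable def pdO (j : Fin n) : O F m n →ₗ[F] O F m n :=
  extend F fun μ =>
    if j ∈ μ.2 then ((-1 : F) ^ (μ.2.filter fun k => k < j).card) • X F (μ.1, μ.2.erase j)
    else 0

/-- Partial derivative indexed by `I = I₀ ⊔ I₁`. -/
noncomputable def pd (i : Fin m ⊕ Fin n) : O F m n →ₗ[F] O F m n :=
  Sum.elim (pdE F) (pdO F) i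

/-- Parity `μ(i)` of an index. -/
def idxPar : Fin m ⊕ Fin n → ℕ := Sum.elim (fun _ => 0) (fun _ => 1)

/-- The sign `τ(i)`. -/
def tau (r : ℕ) : Fin m ⊕ Fin n → ℤ :=
  Sum.elim (fun i => if (i : ℕ) < r then 1 else -1) (fun _ => 1)

/-- The basis vector field `x^(α) x^u ∂_i` of the Witt superalgebra, as an endomorphism. -/
noncomputable def fD (μ : Mono m n) (i : Fin m ⊕ Fin n) : Module.End F (O F m n) :=
  (mulO F (X F μ)).comp (pd F i)

/-- `D_H(x^(α)x^u) = Σ_i τ(i)(−1)^{μ(i)p(f)} ∂_i(f) ∂_{i'}` on a basis monomial. -/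
noncomputable def DHmono (r : ℕ) (pr : Fin m ⊕ Fin n → Fin m ⊕ Fin n) (μ : Mono m n) :
    Module.End F (O F m n) :=
  ∑ i : Fin m ⊕ Fin n,
    (((tau r i : ℤ) : F) * (-1 : F) ^ (idxPar i * μ.2.card)) •
      ((mulO F (pd F i (X F μ))).comp (pd F (pr i)))

/-- The Hamiltonian map `D_H` as a linear map. -/
noncomputable def DH (r : ℕ) (pr : Fin m ⊕ Fin n → Fin m ⊕ Fin n) :
    O F m n →ₗ[F] Module.End F (O F m n) :=
  extend F (DHmono F r pr)

/-- Truncation condition `α ∈ A(m;t)`, i.e. `α_i ≤ π_i = p^{t_i} − 1`. -/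
def inA (p : ℕ) (t : Fin m → ℕ) (α : Fin m → ℕ) : Prop := ∀ i, α i < p ^ t i

/-- The tuple `π`. -/
def piF (p : ℕ) (t : Fin m → ℕ) : Fin m → ℕ := fun i => p ^ t i - 1

/-- The truncated algebra `O(m,n;t)` as a subspace. -/
noncomputable def Ot (p : ℕ) (t : Fin m → ℕ) : Submodule F (O F m n) :=
  Submodule.span F {x | ∃ μ : Mono m n, inA p t μ.1 ∧ x = X F μ}

/-- The even part `H₀̄` of the Hamiltonian superalgebra. -/
noncomputable def H0 (p r : ℕ) (t : Fin m → ℕ) (pr : Fin m ⊕ Fin n → Fin m ⊕ Fin n) :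
    Submodule F (Module.End F (O F m n)) :=
  Submodule.span F {x | ∃ μ : Mono m n, inA p t μ.1 ∧ Even μ.2.card ∧
    ¬(μ.1 = piF p t ∧ μ.2 = Finset.univ) ∧ x = DHmono F r pr μ}

/-- The codimension-one ideal `J` of `H₀̄`. -/
noncomputable def Jid (p r : ℕ) (t : Fin m → ℕ) (pr : Fin m ⊕ Fin n → Fin m ⊕ Fin n) :
    Submodule F (Module.End F (O F m n)) :=
  Submodule.span F {x | ∃ μ : Mono m n, inA p t μ.1 ∧ Even μ.2.card ∧
    ¬(μ.1 = piF p t ∧ μ.2 = Finset.univ) ∧ ¬(μ.1 = piF p t ∧ μ.2 = ∅) ∧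
    x = DHmono F r pr μ}

/-- The odd part `W₁̄` of the Witt superalgebra `W(m,n;t)`. -/
noncomputable def W1 (p : ℕ) (t : Fin m → ℕ) : Submodule F (Module.End F (O F m n)) :=
  Submodule.span F {x | ∃ (μ : Mono m n) (i : Fin m ⊕ Fin n), inA p t μ.1 ∧
    Odd (μ.2.card + idxPar i) ∧ x = fD F μ i}

/-- The `ℤ`-degree-`k` component of `W(m,n;t)`. -/
noncomputable def Wcomp (p : ℕ) (t : Fin m → ℕ) (k : ℤ) :
    Submodule F (Module.End F (O F m n)) :=
  Submodule.span F {x | ∃ (μ : Mono m n) (i : Fin m ⊕ Fin n), inA p t μ.1 ∧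
    (((∑ l, μ.1 l : ℕ) : ℤ) + (μ.2.card : ℤ)) - 1 = k ∧ x = fD F μ i}

/-- The iterated adjoint action `(ad D)^k (E)`. -/
noncomputable def adIter (D : Module.End F (O F m n)) (k : ℕ)
    (E : Module.End F (O F m n)) : Module.End F (O F m n) :=
  (fun E => D * E - E * D)^[k] E

end HamSup

namespace HamSup

section helpers

variable (F : Type) [Field F] {m n : ℕ}

/-- generic version of the map on an associative algebra -/
noncomputable def PhiA {A : Type} [Ring A] [Algebra F A] (L D : A) (k : ℕ) : A →ₗ[F] A :=
  LinearMap.mulLeft F L ∘ₗ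
    ((LinearMap.mulLeft F D - LinearMap.mulRight F D : Module.End F A) ^ k)

lemma PhiA_apply {A : Type} [Ring A] [Algebra F A] (L D : A) (k : ℕ) (E : A) :
    PhiA F L D k E = L * (fun E => D * E - E * D)^[k] E := by
  rw [PhiA, LinearMap.comp_apply, Module.End.pow_apply]
  rfl

lemma ad_char {A : Type} [Ring A] [Algebra F A] [Nontrivial A] (p : ℕ) (hp : p.Prime)
    (hchar : ringChar F = p) (q : ℕ) (D E : A) :
    ((LinearMap.mulLeft F D - LinearMap.mulRight F D : Module.End F A) ^ (p ^ q)) E =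
      D ^ (p ^ q) * E - E * D ^ (p ^ q) := by
  have : Fact p.Prime := ⟨hp⟩
  have : CharP F p := by rw [← hchar]; infer_instance
  have : CharP (Module.End F A) p :=
    charP_of_injective_algebraMap (FaithfulSMul.algebraMap_injective F _) p
  rw [sub_pow_char_pow_of_commute]
  · rw [LinearMap.sub_apply, LinearMap.pow_mulLeft, LinearMap.pow_mulRight]
    rfl
  · exact LinearMap.commute_mulLeft_right D D

lemma PhiA_derivation {A : Type} [Ring A] [Algebra F A] [Nontrivial A] (p : ℕ) (hp : p.Prime)
    (hchar : ringChar F = p) (q : ℕ) (L D x y : A) (hx : x * L = L * x) (hy : y * L = L * y) :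
    PhiA F L D (p ^ q) ⁅x, y⁆ = ⁅PhiA F L D (p ^ q) x, y⁆ + ⁅x, PhiA F L D (p ^ q) y⁆ := by
  simp only [PhiA, LinearMap.comp_apply, ad_char F p hp hchar, LinearMap.mulLeft_apply,
    Ring.lie_def]
  generalize D ^ p ^ q = D
  have hx' : ∀ z, x * (L * z) = L * (x * z) := fun z => by
    rw [← mul_assoc, hx, mul_assoc]
  have hy' : ∀ z, y * (L * z) = L * (y * z) := fun z => by
    rw [← mul_assoc, hy, mul_assoc]
  rw [hx', hy']
  noncomm_ring

lemma extend_X {N : Type} [AddCommGroup N] [Module F N] (v : Mono m n → N) (μ : Mono m n) :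
    extend F v (X F μ) = v μ := by
  simp [extend, X]

lemma end_ext {N : Type} [AddCommMonoid N] [Module F N] {A B : O F m n →ₗ[F] N}
    (h : ∀ μ, A (X F μ) = B (X F μ)) : A = B := by
  apply Finsupp.lhom_ext
  intro a b
  have : Finsupp.single a b = b • X F a := by simp [X]
  rw [this, map_smul, map_smul, h]

lemma mulO_X (μ ν : Mono m n) : mulO F (X F μ) (X F ν) = mulMono F μ ν := by
  simp [mulO, extend_X]

lemma pdE_X (i : Fin m) (μ : Mono m n) : pdE F i (X F μ) =
    if μ.1 i = 0 then 0 else X F (Function.update μ.1 i (μ.1 i - 1), μ.2) := by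
  simp [pdE, extend_X]

lemma pdO_X (j : Fin n) (μ : Mono m n) : pdO F j (X F μ) =
    if j ∈ μ.2 then ((-1 : F) ^ (μ.2.filter fun k => k < j).card) • X F (μ.1, μ.2.erase j)
    else 0 := by
  simp [pdO, extend_X]

/-- left multiplication by `x^ω` -/
noncomputable def Lw : Module.End F (O F m n) :=
  mulO F (X F ((0 : Fin m → ℕ), (Finset.univ : Finset (Fin n))))

lemma disj_univ (v : Finset (Fin n)) : Disjoint (Finset.univ : Finset (Fin n)) v ↔ v = ∅ := by
  constructor
  · intro h
    ext l
    simpa using Finset.disjoint_left.mp h (Finset.mem_univ l)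
  · rintro rfl; simp

lemma disj_univ' (v : Finset (Fin n)) : Disjoint v (Finset.univ : Finset (Fin n)) ↔ v = ∅ := by
  rw [disjoint_comm, disj_univ]

lemma Lw_X (μ : Mono m n) : Lw F (X F μ) = if μ.2 = ∅ then X F (μ.1, Finset.univ) else 0 := by
  rw [Lw, mulO_X, mulMono]
  by_cases h : μ.2 = ∅
  · simp [h, invCount]
  · rw [if_neg h, if_neg]
    rwa [disj_univ]

lemma binom_empty_mul (α : Fin m → ℕ) (ν : Mono m n) :
    mulO F (X F (α, ∅)) (X F ν) =
      (∏ i, ((α i + ν.1 i).choose (α i) : F)) • X F (α + ν.1, ν.2) := by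
  rw [mulO_X, mulMono]
  simp [invCount]

lemma Lw_mulO (μ : Mono m n) :
    Lw F * mulO F (X F μ) = mulO F (Lw F (X F μ)) := by
  apply end_ext
  intro ν
  obtain ⟨α, u⟩ := μ
  obtain ⟨β, v⟩ := ν
  rw [Module.End.mul_apply, Lw_X, mulO_X, mulMono]
  by_cases hu : u = ∅
  · subst hu
    by_cases hv : v = ∅
    · subst hv
      simp [Lw_X, mulO_X, mulMono, invCount]
    · simp [Lw_X, mulO_X, mulMono, disj_univ, hv]
  · split_ifs <;> simp [Lw_X, hu]

lemma mulO_Lw (μ : Mono m n) :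
    mulO F (X F μ) * Lw F = Lw F * mulO F (X F μ) := by
  apply end_ext
  intro ν
  obtain ⟨α, u⟩ := μ
  obtain ⟨β, v⟩ := ν
  rw [Module.End.mul_apply, Module.End.mul_apply, Lw_X, mulO_X, mulMono]
  by_cases hv : v = ∅
  · subst hv
    by_cases hu : u = ∅
    · subst hu
      simp [Lw_X, mulO_X, mulMono, invCount]
    · simp [Lw_X, mulO_X, mulMono, disj_univ', hu]
  · rw [if_neg hv]; split_ifs <;> simp [Lw_X, hv]

lemma pdE_Lw (i : Fin m) : pdE F i * Lw F = Lw F * (pdE F i : Module.End F (O F m n)) := by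
  apply end_ext
  intro ν
  rw [Module.End.mul_apply, Module.End.mul_apply, Lw_X, pdE_X]
  by_cases h : ν.2 = ∅ <;> by_cases h2 : ν.1 i = 0 <;> simp [h, h2, Lw_X, pdE_X]

lemma pdE_pd (i : Fin m) (j : Fin m ⊕ Fin n) :
    pdE F i * pd F j = pd F j * (pdE F i : Module.End F (O F m n)) := by
  apply end_ext
  intro ν
  obtain ⟨α, u⟩ := ν
  rw [Module.End.mul_apply, Module.End.mul_apply]
  rcases j with j | j
  · simp only [pd, Sum.elim_inl, pdE_X]
    by_cases hij : i = j
    · subst hij; rfl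
    · by_cases h1 : α i = 0 <;> by_cases h2 : α j = 0 <;>
        simp [h1, h2, pdE_X, hij, Ne.symm hij, Function.update_of_ne]
      rw [Function.update_comm hij]
  · simp only [pd, Sum.elim_inr, pdE_X, pdO_X]
    by_cases h1 : α i = 0 <;> by_cases h2 : j ∈ u <;> simp [h1, h2, pdE_X, pdO_X]

lemma pdE_mulMono (i : Fin m) (μ ν : Mono m n) :
    pdE F i (mulO F (X F μ) (X F ν)) =
      mulO F (pdE F i (X F μ)) (X F ν) + mulO F (X F μ) (pdE F i (X F ν)) := by
  obtain ⟨α, u⟩ := μ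
  obtain ⟨β, v⟩ := ν
  by_cases hd : Disjoint u v
  swap
  · simp only [mulO_X, mulMono, pdE_X, hd, if_false, map_zero]
    split_ifs <;> simp [mulO_X, mulMono, hd]
  have key : ∀ γ δ : Fin m → ℕ, (∏ k, ((γ k + δ k).choose (γ k) : F)) =
      ((γ i + δ i).choose (γ i) : F) *
        ∏ k ∈ Finset.univ.erase i, ((γ k + δ k).choose (γ k) : F) := fun γ δ =>
    (Finset.mul_prod_erase Finset.univ _ (Finset.mem_univ i)).symm
  have e1 : ∀ a b, ∏ k ∈ Finset.univ.erase i,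
      ((Function.update α i a k + Function.update β i b k).choose (Function.update α i a k) : F)
      = ∏ k ∈ Finset.univ.erase i, ((α k + β k).choose (α k) : F) := by
    intro a b
    apply Finset.prod_congr rfl
    intro k hk
    have hk' := Finset.ne_of_mem_erase hk
    simp [Function.update_of_ne hk']
  have e2 := fun a => e1 a (β i)
  have e3 := fun b => e1 (α i) b
  simp only [Function.update_eq_self] at e2 e3
  have u1 : ∀ a, Function.update α i a + β = Function.update (α + β) i (a + β i) := by
    intro a; ext k; by_cases hk : k = i
    · subst hk; simp
    · simp [hk]
  have u2 : ∀ b, α + Function.update β i b = Function.update (α + β) i (α i + b) := by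
    intro a; ext k; by_cases hk : k = i
    · subst hk; simp
    · simp [hk]
  rw [mulO_X, mulMono, if_pos hd, map_smul, pdE_X, pdE_X, pdE_X]
  simp only [Pi.add_apply]
  rcases ha : α i with _ | a <;> rcases hb : β i with _ | b
  · simp
  · simp [mulO_X, mulMono, hd, key, e3, u2, ha]
  · simp [mulO_X, mulMono, hd, key, e2, u1, ha, hb]
  · have h1 : a + 1 + (b + 1) - 1 = a + (b + 1) := by omega
    have h2 : a + 1 + b = a + (b + 1) := by omega
    simp only [Nat.add_sub_cancel, Function.update_self, h1, h2, Nat.add_eq_zero_iff,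
      one_ne_zero, and_false, if_false, mulO_X, mulMono, hd, if_true, key, e2, e3, u1, u2, ha, hb]
    rw [← add_smul]
    congr 1
    have : a + 1 + (b + 1) = (a + (b + 1)) + 1 := by omega
    rw [this, Nat.choose_succ_succ, Nat.cast_add]
    ring

/-- left multiplication by an endomorphism -/
noncomputable def mL (D : Module.End F (O F m n)) : Module.End F (Module.End F (O F m n)) where
  toFun E := D * E
  map_add' := mul_add D
  map_smul' a E := mul_smul_comm a D E

/-- right multiplication by an endomorphism -/
noncomputable def mR (D : Module.End F (O F m n)) : Module.End F (Module.End F (O F m n)) where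
  toFun E := E * D
  map_add' x y := add_mul x y D
  map_smul' a E := smul_mul_assoc a E D

lemma mL_apply (D E : Module.End F (O F m n)) : mL F D E = D * E := rfl

lemma mR_apply (D E : Module.End F (O F m n)) : mR F D E = E * D := rfl

lemma pdE_mulO (i : Fin m) (f : O F m n) :
    pdE F i * mulO F f = mulO F (pdE F i f) + mulO F f * (pdE F i : Module.End F (O F m n)) := by
  have : (mL F (pdE F i : Module.End F (O F m n))) ∘ₗ (mulO F) =
      mulO F ∘ₗ pdE F i +
      (mR F (pdE F i : Module.End F (O F m n))) ∘ₗ (mulO F) := by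
    apply end_ext
    intro μ
    apply end_ext
    intro ν
    exact pdE_mulMono F i μ ν
  exact LinearMap.congr_fun this f

lemma ad_gD (i : Fin m) (f : O F m n) (j : Fin m ⊕ Fin n) :
    pdE F i * (mulO F f * pd F j) - (mulO F f * pd F j) * pdE F i =
      mulO F (pdE F i f) * (pd F j : Module.End F (O F m n)) := by
  rw [← mul_assoc, pdE_mulO, add_mul, mul_assoc (mulO F f), pdE_pd, mul_assoc (mulO F f)]
  exact add_sub_cancel_right (G := Module.End F (O F m n)) _ _

lemma adIter_gD (i : Fin m) (k : ℕ) (f : O F m n) (j : Fin m ⊕ Fin n) :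
    adIter F (pdE F i) k (mulO F f * pd F j) =
      mulO F (((pdE F i : Module.End F (O F m n)) ^ k) f) *
        (pd F j : Module.End F (O F m n)) := by
  induction k generalizing f with
  | zero => simp [adIter]
  | succ k ih =>
    have h := ih (pdE F i f)
    unfold adIter at h ⊢
    rw [Function.iterate_succ_apply, ad_gD, h, pow_succ]
    rfl

lemma pdE_pow_X (i : Fin m) (k : ℕ) (μ : Mono m n) :
    ((pdE F i : Module.End F (O F m n)) ^ k) (X F μ) =
      if k ≤ μ.1 i then X F (Function.update μ.1 i (μ.1 i - k), μ.2) else 0 := by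
  induction k with
  | zero => simp
  | succ k ih =>
    rw [pow_succ', Module.End.mul_apply, ih]
    by_cases h : k + 1 ≤ μ.1 i
    · have h1 : k ≤ μ.1 i := by omega
      have h2 : μ.1 i - k ≠ 0 := by omega
      simp [h, h1, h2, pdE_X, Nat.sub_sub]
    · by_cases h1 : k ≤ μ.1 i
      · have h2 : μ.1 i - k = 0 := by omega
        simp [h, h1, h2, pdE_X]
      · simp [h, h1]

/-- The map. -/
noncomputable def Phi (i : Fin m) (k : ℕ) :
    Module.End F (O F m n) →ₗ[F] Module.End F (O F m n) :=
  PhiA F (A := Module.End F (O F m n)) (Lw F) (pdE F i) k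

lemma Phi_apply (i : Fin m) (k : ℕ) (E : Module.End F (O F m n)) :
    Phi F i k E = Lw F * adIter F (pdE F i) k E :=
  PhiA_apply F (A := Module.End F (O F m n)) (Lw F) (pdE F i) k E

lemma Phi_fD (i : Fin m) (k : ℕ) (μ : Mono m n) (j : Fin m ⊕ Fin n) :
    Phi F i k (mulO F (X F μ) * pd F j) =
      if k ≤ μ.1 i ∧ μ.2 = ∅ then fD F (Function.update μ.1 i (μ.1 i - k), Finset.univ) j
      else 0 := by
  rw [Phi_apply, adIter_gD, pdE_pow_X]
  by_cases h : k ≤ μ.1 i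
  · rw [if_pos h, ← mul_assoc, Lw_mulO, Lw_X]
    by_cases h2 : μ.2 = ∅
    · simp [h, h2, fD]; rfl
    · simp [h2]
  · simp [h]

lemma Phi_derivation (p : ℕ) (hp : p.Prime) (hchar : ringChar F = p) (q : ℕ) (i : Fin m)
    (x y : Module.End F (O F m n)) (hx : x * Lw F = Lw F * x) (hy : y * Lw F = Lw F * y) :
    Phi F i (p ^ q) ⁅x, y⁆ = ⁅Phi F i (p ^ q) x, y⁆ + ⁅x, Phi F i (p ^ q) y⁆ := by
  exact PhiA_derivation F (A := Module.End F (O F m n)) p hp hchar q (Lw F) (pdE F i) x y hx hy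

lemma inv_single (k : Fin n) (v : Finset (Fin n)) (hv : v = Finset.univ.erase k) :
    invCount {k} v = (Finset.univ.filter fun l : Fin n => l < k).card := by
  subst hv
  unfold invCount
  apply Finset.card_bij (fun a _ => a.2)
  · intro a ha; simp at ha ⊢; grind
  · rintro ⟨a, b⟩ ha ⟨c, d⟩ hc h; simp at *; grind
  · intro b hb; simp at hb ⊢; exact ⟨hb.ne, hb⟩

/-- product of a monomial with an odd derivative of the top monomial -/
lemma mul_pdO_top (α β : Fin m → ℕ) (w : Finset (Fin n)) (hw : w ≠ ∅) (k : Fin n) :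
    mulO F (X F (α, w)) (pdO F k (X F (β, Finset.univ))) =
      if w = {k} then (∏ i, ((α i + β i).choose (α i) : F)) • X F (α + β, Finset.univ) else 0 := by
  rw [pdO_X]
  simp only [Finset.mem_univ, if_true, map_smul, mulO_X, mulMono]
  by_cases h : w = {k}
  · subst h
    rw [if_pos (by simp), if_pos rfl, inv_single k _ rfl, smul_smul, ← mul_assoc, ← pow_add,
      Even.neg_one_pow (Even.add_self _), one_mul]
    have : ({k} : Finset (Fin n)) ∪ Finset.univ.erase k = Finset.univ := by
      ext l; simp [em]
    rw [this]
  · rw [if_neg, if_neg h, smul_zero]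
    intro hd
    apply h
    ext l
    have hsub : ∀ l ∈ w, l = k := by
      intro l hl
      by_contra hne
      exact Finset.disjoint_left.mp hd hl (by simp [hne])
    obtain ⟨a, ha⟩ := Finset.nonempty_iff_ne_empty.mpr hw
    have := hsub a ha
    subst this
    simp only [Finset.mem_singleton]
    exact ⟨hsub l, fun h => h ▸ ha⟩

lemma odd_sum_zero (prO : Fin n → Fin n) (hinv : ∀ j, prO (prO j) = j) (μ : Mono m n)
    (hμ : Even μ.2.card) (β : Fin m → ℕ) :
    ∑ j : Fin n, mulO F (pdO F j (X F μ)) (pdO F (prO j) (X F (β, Finset.univ))) = 0 := by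
  obtain ⟨α, u⟩ := μ
  set T : O F m n := (∏ i, ((α i + β i).choose (α i) : F)) • X F (α + β, Finset.univ) with hT
  have hterm : ∀ j : Fin n, mulO F (pdO F j (X F (α, u))) (pdO F (prO j) (X F (β, Finset.univ)))
      = if j ∈ u ∧ u.erase j = {prO j} then
        ((-1 : F) ^ (u.filter fun k => k < j).card) • T else 0 := by
    intro j
    rw [pdO_X]
    by_cases hj : j ∈ u
    · have hne : u.erase j ≠ ∅ := by
        intro h
        have := Finset.card_erase_of_mem hj
        rw [h, Finset.card_empty] at this
        have h2 : 0 < u.card := Finset.card_pos.mpr ⟨j, hj⟩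
        simp only at hμ
        obtain ⟨c, hc⟩ := hμ
        omega
      simp only [hj, if_true, true_and, map_smul, LinearMap.smul_apply]
      rw [mul_pdO_top F α β _ hne]
      split_ifs <;> simp [hT]
    · simp [hj]
  simp only [hterm]
  have hstep : ∀ j, (j ∈ u ∧ u.erase j = {prO j}) → (prO j ∈ u ∧ u.erase (prO j) = {j}) := by
    rintro j ⟨hj, he⟩
    have h1 : prO j ∈ u.erase j := by rw [he]; simp
    refine ⟨Finset.mem_of_mem_erase h1, ?_⟩
    have hne : prO j ≠ j := Finset.ne_of_mem_erase h1
    have hu : u = insert j {prO j} := by rw [← he, Finset.insert_erase hj]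
    rw [hu]; ext l; simp; grind
  apply Finset.sum_involution (fun j _ => prO j)
  · intro j _
    by_cases h : j ∈ u ∧ u.erase j = {prO j}
    · have h' := hstep j h
      rw [if_pos h, hinv, if_pos h', ← add_smul]
      have h1 : prO j ∈ u.erase j := by rw [h.2]; simp
      have hne : prO j ≠ j := Finset.ne_of_mem_erase h1
      have hu : u = insert j {prO j} := by rw [← h.2, Finset.insert_erase h.1]
      rcases lt_or_gt_of_ne hne with hlt | hlt
      · have a1 : (u.filter fun k => k < j) = {prO j} := by
          rw [hu]; ext l; simp; grind
        have a2 : (u.filter fun k => k < prO j) = ∅ := by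
          rw [hu]; ext l; simp; grind
        rw [a1, a2]; simp
      · have a1 : (u.filter fun k => k < j) = ∅ := by
          rw [hu]; ext l; simp; grind
        have a2 : (u.filter fun k => k < prO j) = {j} := by
          rw [hu]; ext l; simp; grind
        rw [a1, a2]; simp
    · rw [if_neg h, if_neg, add_zero]
      intro h'
      rw [hinv] at h'
      apply h
      have := hstep (prO j) (by rw [hinv]; exact h')
      rwa [hinv] at this
  · intro j _ hj heq
    have h : j ∈ u ∧ u.erase j = {prO j} := by
      by_contra h
      exact hj (if_neg h)
    have h1 : prO j ∈ u.erase j := by rw [h.2]; simp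
    exact Finset.ne_of_mem_erase h1 heq
  · intro j _; exact Finset.mem_univ _
  · intro j _; exact hinv j

lemma DHmono_split (r : ℕ) (prE : Fin m → Fin m) (prO : Fin n → Fin n) (μ : Mono m n)
    (hμ : Even μ.2.card) :
    DHmono F r (Sum.map prE prO) μ =
      (∑ j : Fin m, ((tau r (Sum.inl j : Fin m ⊕ Fin n) : ℤ) : F) •
        (mulO F (pdE F j (X F μ)) * (pdE F (prE j) : Module.End F (O F m n)))) +
      ∑ j : Fin n, mulO F (pdO F j (X F μ)) * (pdO F (prO j) : Module.End F (O F m n)) := by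
  unfold DHmono
  rw [Fintype.sum_sum_type]
  congr 1
  · apply Finset.sum_congr rfl
    intro j _
    simp [idxPar, pd]; rfl
  · apply Finset.sum_congr rfl
    intro j _
    simp [idxPar, pd, tau, hμ.neg_one_pow]; rfl

lemma odd_Lw_zero (j : Fin n) (μ : Mono m n) (hμ : Even μ.2.card) :
    Lw F (pdO F j (X F μ)) = 0 := by
  rw [pdO_X]
  by_cases hj : j ∈ μ.2
  · have hne : μ.2.erase j ≠ ∅ := by
      intro h
      have := Finset.card_erase_of_mem hj
      rw [h, Finset.card_empty] at this
      have h2 : 0 < μ.2.card := Finset.card_pos.mpr ⟨j, hj⟩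
      obtain ⟨c, hc⟩ := hμ
      omega
    simp only [hj, if_true, map_smul, Lw_X, hne, if_false, smul_zero]
  · simp [hj]

lemma Lw_mulO' (f : O F m n) : Lw F * mulO F f = mulO F (Lw F f) := by
  have : (mL F (Lw F : Module.End F (O F m n))) ∘ₗ (mulO F) =
      mulO F ∘ₗ Lw F := end_ext F (fun μ => Lw_mulO F μ)
  exact LinearMap.congr_fun this f

lemma mulO_Lw' (f : O F m n) : mulO F f * Lw F = Lw F * mulO F f := by
  have : (mR F (Lw F : Module.End F (O F m n))) ∘ₗ (mulO F) =
      (mL F (Lw F : Module.End F (O F m n))) ∘ₗ (mulO F) :=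
    end_ext F (fun μ => mulO_Lw F μ)
  exact LinearMap.congr_fun this f

lemma DHmono_comm (r : ℕ) (prE : Fin m → Fin m) (prO : Fin n → Fin n)
    (hinv : ∀ j, prO (prO j) = j) (μ : Mono m n) (hμ : Even μ.2.card) :
    DHmono F r (Sum.map prE prO) μ * Lw F = Lw F * DHmono F r (Sum.map prE prO) μ := by
  rw [DHmono_split F r prE prO μ hμ, add_mul, mul_add]
  congr 1
  · rw [Finset.sum_mul, Finset.mul_sum]
    apply Finset.sum_congr rfl
    intro j _
    rw [smul_mul_assoc, mul_smul_comm, mul_assoc, pdE_Lw, ← mul_assoc, mulO_Lw', mul_assoc]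
  · have h1 : Lw F * ∑ j : Fin n, mulO F (pdO F j (X F μ)) *
        (pdO F (prO j) : Module.End F (O F m n)) = 0 := by
      rw [Finset.mul_sum]
      apply Finset.sum_eq_zero
      intro j _
      rw [← mul_assoc, Lw_mulO', odd_Lw_zero F j μ hμ, map_zero, zero_mul]
    rw [h1]
    apply end_ext
    intro ν
    rw [Module.End.mul_apply, Lw_X]
    split_ifs with hν
    · rw [LinearMap.sum_apply]
      exact odd_sum_zero F prO hinv μ hμ ν.1
    · simp

lemma H0_comm (p r : ℕ) (t : Fin m → ℕ) (prE : Fin m → Fin m) (prO : Fin n → Fin n)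
    (hinv : ∀ j, prO (prO j) = j) (x : Module.End F (O F m n))
    (hx : x ∈ H0 F p r t (Sum.map prE prO)) : x * Lw F = Lw F * x := by
  unfold H0 at hx
  induction hx using Submodule.span_induction with
  | mem x h =>
    obtain ⟨μ, _, he, _, rfl⟩ := h
    exact DHmono_comm F r prE prO hinv μ he
  | zero => simp
  | add x y _ _ hx hy => rw [add_mul, mul_add, hx, hy]
  | smul a x _ hx => rw [smul_mul_assoc, mul_smul_comm, hx]

lemma inA_update (p : ℕ) (t α : Fin m → ℕ) (h : inA p t α) (i : Fin m) (k : ℕ) :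
    inA p t (Function.update α i (α i - k)) := by
  intro l
  by_cases hl : l = i
  · subst hl
    have := h l
    simp only [Function.update_self]
    omega
  · simpa [hl] using h l

lemma Phi_DHmono_mem (p r : ℕ) (t : Fin m → ℕ) (prE : Fin m → Fin m) (prO : Fin n → Fin n)
    (hn : Odd n) (i : Fin m) (k : ℕ) (μ : Mono m n) (hA : inA p t μ.1) (hμ : Even μ.2.card) :
    Phi F i k (DHmono F r (Sum.map prE prO) μ) ∈ W1 F p t := by
  rw [DHmono_split F r prE prO μ hμ, map_add, map_sum, map_sum]
  apply Submodule.add_mem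
  · apply Submodule.sum_mem
    intro j _
    rw [map_smul]
    apply Submodule.smul_mem
    rw [pdE_X]
    split_ifs with h
    · simp
    · have := Phi_fD F i k (Function.update μ.1 j (μ.1 j - 1), μ.2) (Sum.inl (prE j))
      simp only [pd, Sum.elim_inl] at this
      rw [this]
      split_ifs with h2
      · apply Submodule.subset_span
        refine ⟨_, Sum.inl (prE j), ?_, ?_, rfl⟩
        · exact inA_update p t _ (inA_update p t _ hA j 1) i k
        · simpa [idxPar] using hn
      · exact Submodule.zero_mem _
  · apply Submodule.sum_mem
    intro j _
    rw [pdO_X]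
    split_ifs with h
    · have hne : μ.2.erase j ≠ ∅ := by
        intro h'
        have := Finset.card_erase_of_mem h
        rw [h', Finset.card_empty] at this
        have h2 : 0 < μ.2.card := Finset.card_pos.mpr ⟨j, h⟩
        obtain ⟨c, hc⟩ := hμ
        omega
      have := Phi_fD F i k (μ.1, μ.2.erase j) (Sum.inr (prO j))
      simp only [pd, Sum.elim_inr, hne, and_false, if_false] at this
      rw [map_smul, smul_mul_assoc, map_smul, this, smul_zero]
      exact Submodule.zero_mem _
    · simp

lemma Phi_Wcomp (p : ℕ) (t : Fin m → ℕ) (i : Fin m) (P : ℕ) (k : ℤ)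
    (x : Module.End F (O F m n)) (hx : x ∈ Wcomp F p t k) :
    Phi F i P x ∈ Wcomp F p t (k + (n : ℤ) - (P : ℤ)) := by
  unfold Wcomp at hx
  induction hx using Submodule.span_induction with
  | mem x h =>
    obtain ⟨μ, j, hA, hd, rfl⟩ := h
    have := Phi_fD F i P μ j
    change Phi F i P (mulO F (X F μ) * pd F j) ∈ _
    rw [this]
    split_ifs with h
    · apply Submodule.subset_span
      refine ⟨_, j, inA_update p t _ hA i P, ?_, rfl⟩
      have e1 : ∑ l, μ.1 l = μ.1 i + ∑ l ∈ Finset.univ.erase i, μ.1 l :=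
        (Finset.add_sum_erase _ _ (Finset.mem_univ i)).symm
      have e2 : ∑ l, Function.update μ.1 i (μ.1 i - P) l =
          (μ.1 i - P) + ∑ l ∈ Finset.univ.erase i, μ.1 l := by
        rw [← Finset.add_sum_erase _ _ (Finset.mem_univ i), Function.update_self]
        congr 1
        apply Finset.sum_congr rfl
        intro l hl
        rw [Function.update_of_ne (Finset.ne_of_mem_erase hl)]
      rw [e1, h.2, Finset.card_empty] at hd
      simp only [Finset.card_univ, Fintype.card_fin]
      rw [e2]
      have := h.1
      omega
    · exact Submodule.zero_mem _
  | zero => simp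
  | add x y _ _ hx hy => rw [map_add]; exact Submodule.add_mem _ hx hy
  | smul a x _ hx => rw [map_smul]; exact Submodule.smul_mem _ _ hx

end helpers

end HamSup


open HamSup in
/-- for `n` odd, `Θ_i^(q) : D_H(f) ↦ x^ω · (ad ∂_i)^(p^q)(D_H(f))` is a
derivation `H₀̄ → W₁̄` of `ℤ`-degree `n − p^q`. -/
theorem Theta_derivation (F : Type) [Field F] (m n p : ℕ) (hp : p.Prime) (h3 : 3 < p)
    (hchar : ringChar F = p) (r s : ℕ) (hm : m = 2 * r) (hn : n = 2 * s + 1)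
    (t : Fin m → ℕ) (ht : ∀ i, 0 < t i)
    (prE : Fin m → Fin m)
    (hprE : ∀ i : Fin m, (prE i : ℕ) = if (i : ℕ) < r then (i : ℕ) + r else (i : ℕ) - r)
    (prO : Fin n → Fin n)
    (hprO : ∀ j : Fin n, (prO j : ℕ) =
      if (j : ℕ) < s then (j : ℕ) + s else if (j : ℕ) < 2 * s then (j : ℕ) - s else (j : ℕ)) (i : Fin m) (q : ℕ) :
    ∃ φ : Module.End F (O F m n) →ₗ[F] Module.End F (O F m n),
      (∀ μ : Mono m n, inA p t μ.1 → Even μ.2.card →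
        ¬(μ.1 = piF p t ∧ μ.2 = Finset.univ) →
        φ (DHmono F r (Sum.map prE prO) μ) =
          (mulO F (X F ((0 : Fin m → ℕ), (Finset.univ : Finset (Fin n))))).comp
            (adIter F (pdE F i) (p ^ q) (DHmono F r (Sum.map prE prO) μ))) ∧
      (∀ x, x ∈ H0 F p r t (Sum.map prE prO) → φ x ∈ W1 F p t) ∧
      (∀ x, x ∈ H0 F p r t (Sum.map prE prO) → ∀ y, y ∈ H0 F p r t (Sum.map prE prO) →
      φ ⁅x, y⁆ = ⁅φ x, y⁆ + ⁅x, φ y⁆) ∧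
      (∀ k : ℤ, ∀ x, x ∈ H0 F p r t (Sum.map prE prO) → x ∈ Wcomp F p t k →
        φ x ∈ Wcomp F p t (k + (n : ℤ) - ((p ^ q : ℕ) : ℤ))) := by
  have hinv : ∀ j, prO (prO j) = j := by
    intro j
    apply Fin.ext
    have h1 := hprO j
    have h2 := hprO (prO j)
    have := j.isLt
    split_ifs at h1 h2 <;> omega
  refine ⟨Phi F i (p ^ q), ?_, ?_, ?_, ?_⟩
  · intro μ _ _ _
    exact Phi_apply F i (p ^ q) _
  · intro x hx
    unfold H0 at hx
    induction hx using Submodule.span_induction with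
    | mem x h =>
      obtain ⟨μ, hA, he, _, rfl⟩ := h
      exact Phi_DHmono_mem F p r t prE prO ⟨s, hn⟩ i _ μ hA he
    | zero => simp
    | add x y _ _ hx hy => rw [map_add]; exact Submodule.add_mem _ hx hy
    | smul a x _ hx => rw [map_smul]; exact Submodule.smul_mem _ _ hx
  · intro x hx y hy
    exact Phi_derivation F p hp hchar q i x y (H0_comm F p r t prE prO hinv x hx)
      (H0_comm F p r t prE prO hinv y hy)
  · intro k x _ hx
    exact Phi_Wcomp F p t i (p ^ q) k x hx
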